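/- Let A be a commutative ring and let P be a finitely generated projective A-module. If the base change P ⊗_A A((t)) is a free A((t))-module, then P is a free A-module. (Equivalently, for G = GL_n: no nontrivial G-torsor over A trivializes over A((t)), i.e., the kernel of H¹(A, GL_n) → H¹(A((t)), GL_n) is trivial.) -/

import Mathlib

set_option synthInstance.maxHeartbeats 1000000

open TensorProduct

namespace LaurentPolynomial

variable {R : Type*} [CommRing R]

theorem coeff_T_mul (d i : ℤ) (f : R[T;T⁻¹]) : (T d * f).coeff i = f.coeff (i - d) := by
  rw [T, AddMonoidAlgebra.coeff_single_mul_eq_mul_coeff (i - d) (fun j _ ↦ by grind), one_mul]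

theorem coeff_mul_C (r : R) (i : ℤ) (f : R[T;T⁻¹]) : (f * C r).coeff i = f.coeff i * r := by
  rw [← single_eq_C, AddMonoidAlgebra.coeff_mul_single_eq_coeff_mul i (fun j _ ↦ by grind)]

theorem coeff_toLaurent_natCast (p : Polynomial R) (n : ℕ) :
    (Polynomial.toLaurent p).coeff (n : ℤ) = p.coeff n := by
  rw [LaurentPolynomial.coeff_toLaurent]
  exact Finsupp.mapDomain_apply Nat.cast_injective _ _

theorem coeff_toLaurent_of_neg (p : Polynomial R) {i : ℤ} (hi : i < 0) :
    (Polynomial.toLaurent p).coeff i = 0 := by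
  rw [LaurentPolynomial.coeff_toLaurent]
  refine Finsupp.mapDomain_of_notMem_range _ _ ?_
  rintro ⟨n, rfl⟩
  simp at hi
  omega

theorem coeff_mul_mem (I : Ideal R) {f g : R[T;T⁻¹]} {i : ℤ}
    (h : ∀ j k, j + k = i → f.coeff j * g.coeff k ∈ I) : (f * g).coeff i ∈ I := by
  classical
  rw [AddMonoidAlgebra.coeff_mul]
  refine Ideal.sum_mem _ fun j _ ↦ Ideal.sum_mem _ fun k _ ↦ ?_
  dsimp only
  split_ifs with hjk
  exacts [h j k hjk, I.zero_mem]

/-- The subring of Laurent polynomials that are polynomials modulo the ideal `I`. -/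
def polynomialMod (I : Ideal R) : Subring R[T;T⁻¹] where
  carrier := {f | ∀ i < 0, f.coeff i ∈ I}
  mul_mem' {f g} hf hg i hi := coeff_mul_mem I fun j k hjk ↦ by
    obtain hj | hk : j < 0 ∨ k < 0 := by omega
    exacts [I.mul_mem_right _ (hf j hj), I.mul_mem_left _ (hg k hk)]
  one_mem' i hi := by simp [← T_zero, hi.ne']
  add_mem' hf hg i hi := I.add_mem (hf i hi) (hg i hi)
  zero_mem' i hi := I.zero_mem
  neg_mem' hf i hi := I.neg_mem (hf i hi)

theorem mem_polynomialMod {I : Ideal R} {f : R[T;T⁻¹]} :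
    f ∈ polynomialMod I ↔ ∀ i < 0, f.coeff i ∈ I := Iff.rfl

theorem toLaurent_mem_polynomialMod (I : Ideal R) (p : Polynomial R) :
    Polynomial.toLaurent p ∈ polynomialMod I := fun i hi ↦ by
  rw [coeff_toLaurent_of_neg _ hi]
  exact I.zero_mem

theorem C_mem_polynomialMod (I : Ideal R) (r : R) : C r ∈ polynomialMod I := by
  rw [← Polynomial.toLaurent_C]
  exact toLaurent_mem_polynomialMod I _

theorem T_mem_polynomialMod (I : Ideal R) (n : ℕ) : T n ∈ polynomialMod I := by
  rw [← Polynomial.toLaurent_X_pow]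
  exact toLaurent_mem_polynomialMod I _

theorem nonneg_of_T_mem_polynomialMod {I : Ideal R} (hI : I ≠ ⊤) {d : ℤ}
    (h : T d ∈ polynomialMod I) : 0 ≤ d := by
  by_contra! hd
  exact hI ((Ideal.eq_top_iff_one I).2 (by simpa using h d hd))

theorem exists_toLaurent_eq_T_mul {ι : Type*} [Finite ι] (f : ι → R[T;T⁻¹]) :
    ∃ N : ℕ, ∀ n : ℕ, N ≤ n → ∀ i, ∃ p : Polynomial R, Polynomial.toLaurent p = T n * f i := by
  cases nonempty_fintype ι
  choose N p hp using fun i ↦ exists_T_pow (f i)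
  refine ⟨Finset.univ.sup N, fun n hn i ↦ ?_⟩
  obtain ⟨k, rfl⟩ := Nat.exists_eq_add_of_le ((Finset.le_sup (Finset.mem_univ i)).trans hn)
  refine ⟨p i * Polynomial.X ^ k, ?_⟩
  rw [map_mul, hp, Polynomial.toLaurent_X_pow, mul_assoc, ← T_add, mul_comm]
  push_cast
  rfl

theorem exists_T_mul_mem_polynomialMod {I : Ideal R} {ι : Type*} [Finite ι]
    (f : ι → R[T;T⁻¹]) : ∃ N : ℕ, ∀ i, T N * f i ∈ polynomialMod I := by
  obtain ⟨N, hN⟩ := exists_toLaurent_eq_T_mul f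
  refine ⟨N, fun i ↦ ?_⟩
  obtain ⟨p, hp⟩ := hN N le_rfl i
  exact hp ▸ toLaurent_mem_polynomialMod I p

theorem exists_mul_C_eq_one_sub [IsLocalRing R] {f : R[T;T⁻¹]}
    (hf : f ∈ polynomialMod (IsLocalRing.maximalIdeal R))
    (hf' : T (-1) * f ∉ polynomialMod (IsLocalRing.maximalIdeal R)) :
    ∃ u : R, ∃ q ∈ polynomialMod (IsLocalRing.maximalIdeal R), f * C u = 1 - q * T 1 := by
  rw [mem_polynomialMod] at hf hf'
  push Not at hf'
  obtain ⟨i, hi, hfi⟩ := hf'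
  rw [coeff_T_mul] at hfi
  obtain rfl : i = -1 := by
    by_contra h
    exact hfi (hf _ (by omega))
  rw [IsLocalRing.notMem_maximalIdeal] at hfi
  obtain ⟨u, hu⟩ := hfi.exists_right_inv
  refine ⟨u, T (-1) * (1 - f * C u), fun j hj ↦ ?_, ?_⟩
  · rw [coeff_T_mul, AddMonoidAlgebra.coeff_sub, Finsupp.sub_apply, coeff_mul_C, ← T_zero, T_apply]
    obtain rfl | hj := eq_or_ne j (-1)
    · simp at hu ⊢
      simp [hu]
    · rw [if_neg (by omega), zero_sub]
      exact neg_mem (Ideal.mul_mem_right _ _ (hf _ (by omega)))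
  · rw [mul_right_comm, ← T_add]
    simp

open scoped Matrix in
theorem exists_primitive_row [IsLocalRing R] {ι : Type*} [Fintype ι] (α β : ι → R[T;T⁻¹])
    (h : β ⬝ᵥ α = 1) :
    ∃ d : ℤ, (∀ p, T d * α p ∈ polynomialMod (IsLocalRing.maximalIdeal R)) ∧
      ∃ w : ι → R[T;T⁻¹], (∀ p, w p ∈ polynomialMod (IsLocalRing.maximalIdeal R)) ∧
        w ⬝ᵥ (fun p ↦ T d * α p) = 1 := by
  classical
  set B := polynomialMod (IsLocalRing.maximalIdeal R)
  obtain ⟨N, hN⟩ := exists_T_mul_mem_polynomialMod (I := IsLocalRing.maximalIdeal R) β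
  obtain ⟨d, hd, hmin⟩ := Int.exists_least_of_bdd
    (P := fun d ↦ ∀ p, T d * α p ∈ B)
    ⟨-N, fun d hd ↦ by
      have : T (N + d) ∈ B := by
        have : T (N + d) = ∑ p, (T N * β p) * (T d * α p) := by
          rw [T_add, ← mul_one (T (N : ℤ) * T d), ← h, dotProduct, Finset.mul_sum]
          exact Finset.sum_congr rfl fun p _ ↦ by ring
        rw [this]
        exact sum_mem fun p _ ↦ mul_mem (hN p) (hd p)
      have := nonneg_of_T_mem_polynomialMod (IsLocalRing.maximalIdeal.isMaximal R).ne_top this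
      omega⟩
    (by
      obtain ⟨M, hM⟩ := exists_T_mul_mem_polynomialMod (I := IsLocalRing.maximalIdeal R) α
      exact ⟨M, hM⟩)
  obtain ⟨p, hp⟩ : ∃ p, T (d - 1) * α p ∉ B := by
    by_contra! hall
    have := hmin _ hall
    omega
  obtain ⟨u, q, hq, huq⟩ := exists_mul_C_eq_one_sub (hd p) (by
    rwa [← mul_assoc, ← T_add, show -1 + d = d - 1 by ring])
  obtain ⟨M, hM⟩ := exists_T_mul_mem_polynomialMod (I := IsLocalRing.maximalIdeal R)
    fun p ↦ T (-d) * β p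
  refine ⟨d, hd, Pi.single p (C u * ∑ j ∈ Finset.range M, (q * T 1) ^ j) +
    q ^ M • fun p ↦ T M * (T (-d) * β p), fun r ↦ ?_, ?_⟩
  · refine add_mem ?_ (mul_mem (pow_mem hq _) (hM r))
    by_cases hr : r = p
    · subst hr
      rw [Pi.single_eq_same]
      exact mul_mem (C_mem_polynomialMod _ _) (sum_mem fun j _ ↦ pow_mem (mul_mem hq
        (by simpa using T_mem_polynomialMod (IsLocalRing.maximalIdeal R) 1)) _)
    · rw [Pi.single_eq_of_ne hr]
      exact zero_mem _
  · have hβ : (fun p ↦ T M * (T (-d) * β p)) ⬝ᵥ (fun p ↦ T d * α p) = T M := by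
      trans T M * (β ⬝ᵥ α)
      swap
      · rw [h, mul_one]
      rw [dotProduct, dotProduct, Finset.mul_sum]
      refine Finset.sum_congr rfl fun p _ ↦ ?_
      have : (T (-d) * T d : R[T;T⁻¹]) = 1 := by simp only [← T_add, neg_add_cancel, T_zero]
      linear_combination (T M * β p * α p) * this
    rw [add_dotProduct, single_dotProduct, smul_dotProduct, hβ, smul_eq_mul]
    have hT : (T M : R[T;T⁻¹]) = T 1 ^ M := by simp [T_pow]
    have := mul_neg_geom_sum (q * T 1) M
    rw [hT, ← mul_pow]
    linear_combination this + (∑ j ∈ Finset.range M, (q * T 1) ^ j) * huq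

open scoped Matrix in
theorem exists_dual_families_polynomialMod [IsLocalRing R] {ι : Type*} [Fintype ι] (n : ℕ)
    (a b : Fin n → ι → R[T;T⁻¹]) (hba : ∀ i j, b i ⬝ᵥ a j = if i = j then 1 else 0)
    (hab : ∀ p q, ∑ i, a i p * b i q ∈ polynomialMod (IsLocalRing.maximalIdeal R)) :
    ∃ a' b' : Fin n → ι → R[T;T⁻¹], (∀ i j, b' i ⬝ᵥ a' j = if i = j then 1 else 0) ∧
      (∀ p q, ∑ i, a' i p * b' i q = ∑ i, a i p * b i q) ∧
      (∀ i p, a' i p ∈ polynomialMod (IsLocalRing.maximalIdeal R)) ∧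
      ∀ i p, b' i p ∈ polynomialMod (IsLocalRing.maximalIdeal R) := by
  induction n with
  | zero => exact ⟨a, b, hba, fun _ _ ↦ rfl, fun i ↦ i.elim0, fun i ↦ i.elim0⟩
  | succ n ih =>
    obtain ⟨d, hd, w, hw, hw1⟩ := exists_primitive_row (a 0) (b 0) (by simp [hba])
    set a₀ : ι → R[T;T⁻¹] := fun p ↦ T d * a 0 p
    have hTT : (T d * T (-d) : R[T;T⁻¹]) = 1 := by simp only [← T_add, add_neg_cancel, T_zero]
    set c : Fin n → R[T;T⁻¹] := fun j ↦ w ⬝ᵥ a j.succ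
    set b₀ : ι → R[T;T⁻¹] := (T (-d) : R[T;T⁻¹]) • b 0 + ∑ j, c j • b j.succ
    set a₁ : Fin n → ι → R[T;T⁻¹] := fun j ↦ a j.succ - c j • a₀
    have ha₀ : a₀ = (T d : R[T;T⁻¹]) • a 0 := rfl
    have hb₀ (q) : b₀ q = ∑ p, w p * ∑ i, a i p * b i q := by
      simp_rw [Finset.mul_sum]
      rw [Finset.sum_comm, Fin.sum_univ_succ]
      simp only [b₀, c, Pi.add_apply, Finset.sum_apply, Pi.smul_apply, smul_eq_mul]
      congr 1
      · rw [← one_mul (T (-d) * b 0 q), ← hw1, dotProduct, Finset.sum_mul]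
        refine Finset.sum_congr rfl fun p _ ↦ ?_
        linear_combination (w p * a 0 p * b 0 q) * hTT
      · refine Finset.sum_congr rfl fun j _ ↦ ?_
        rw [dotProduct, Finset.sum_mul]
        exact Finset.sum_congr rfl fun p _ ↦ by ring
    have hb₀mem (q) : b₀ q ∈ polynomialMod (IsLocalRing.maximalIdeal R) := by
      rw [hb₀]
      exact sum_mem fun p _ ↦ mul_mem (hw p) (hab p q)
    have h00 : b₀ ⬝ᵥ a₀ = 1 := by
      simp only [b₀, ha₀, add_dotProduct, smul_dotProduct, dotProduct_smul, sum_dotProduct, hba]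
      simp [hTT]
    have h01 (i) : b₀ ⬝ᵥ a₁ i = 0 := by
      simp only [a₁, dotProduct_sub, dotProduct_smul, h00]
      simp only [b₀, add_dotProduct, smul_dotProduct, sum_dotProduct, hba]
      simp [(Fin.succ_ne_zero _).symm]
    have h1 (i j) : b (Fin.succ i) ⬝ᵥ a₁ j = if i = j then 1 else 0 := by
      simp [a₁, ha₀, hba]
    have h10 (i) : b (Fin.succ i) ⬝ᵥ a₀ = 0 := by simp [ha₀, hba]
    have hsum (p q) : ∑ i, a₁ i p * b (Fin.succ i) q =
        ∑ i, a i p * b i q - a₀ p * b₀ q := by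
      simp only [a₁, b₀, Fin.sum_univ_succ (fun i ↦ a i p * b i q), Pi.add_apply,
        Finset.sum_apply, Pi.smul_apply, smul_eq_mul, Pi.sub_apply, sub_mul,
        Finset.sum_sub_distrib, mul_add, Finset.mul_sum, ha₀]
      have : ∑ j, c j * (T d * a 0 p) * b (Fin.succ j) q =
          ∑ j, T d * a 0 p * (c j * b (Fin.succ j) q) :=
        Finset.sum_congr rfl fun j _ ↦ by ring
      linear_combination - this + (a 0 p * b 0 q) * hTT
    obtain ⟨a', b', hba', hab', ha', hb'⟩ := ih a₁ (fun i ↦ b i.succ) h1 fun p q ↦ by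
      rw [hsum]
      exact sub_mem (hab p q) (mul_mem (hd p) (hb₀mem q))
    -- the matrix `∑ i, a' i ⬝ b' i` fixes `a'` and `b'`, and is killed by `a₀` and `b₀`
    have hE : (∑ i, Matrix.vecMulVec (a' i) (b' i)) =
        ∑ i, Matrix.vecMulVec (a₁ i) (b (Fin.succ i)) := by
      refine Matrix.ext fun p q ↦ ?_
      simpa [Matrix.sum_apply, Matrix.vecMulVec_apply] using hab' p q
    have h0a' (j) : b₀ ⬝ᵥ a' j = 0 := by
      have : (∑ i, Matrix.vecMulVec (a' i) (b' i)) *ᵥ a' j = a' j := by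
        simp [Matrix.sum_mulVec, Matrix.vecMulVec_mulVec, hba']
      rw [← this, hE, Matrix.sum_mulVec, dotProduct_sum]
      refine Finset.sum_eq_zero fun i _ ↦ ?_
      simp [Matrix.vecMulVec_mulVec, h01]
    have hb'0 (j) : b' j ⬝ᵥ a₀ = 0 := by
      have : b' j ᵥ* (∑ i, Matrix.vecMulVec (a' i) (b' i)) = b' j := by
        simp [Matrix.vecMul_sum, Matrix.vecMul_vecMulVec, hba']
      rw [← this, hE, Matrix.vecMul_sum, sum_dotProduct]
      refine Finset.sum_eq_zero fun i _ ↦ ?_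
      simp [Matrix.vecMul_vecMulVec, h10]
    refine ⟨Fin.cons a₀ a', Fin.cons b₀ b', ?_, ?_, ?_, ?_⟩
    · intro i j
      cases i using Fin.cases <;> cases j using Fin.cases <;>
        simp [h00, h0a', hb'0, hba', Fin.succ_ne_zero, (Fin.succ_ne_zero _).symm]
    · intro p q
      rw [Fin.sum_univ_succ]
      simp [hab', hsum]
    · intro i p
      cases i using Fin.cases
      exacts [hd p, ha' _ p]
    · intro i p
      cases i using Fin.cases
      exacts [hb₀mem p, hb' _ p]

/-- The submodule `T⁻¹ R[T⁻¹]` of `R[T;T⁻¹]`. -/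
def negativePart (R : Type*) [CommRing R] : Submodule R R[T;T⁻¹] where
  carrier := {f | ∀ i, 0 ≤ i → f.coeff i = 0}
  add_mem' hf hg i hi := by
    rw [AddMonoidAlgebra.coeff_add, Finsupp.add_apply, hf i hi, hg i hi, add_zero]
  zero_mem' i _ := rfl
  smul_mem' r f hf i hi := by
    rw [AddMonoidAlgebra.coeff_smul, Finsupp.smul_apply, hf i hi, smul_zero]

theorem mul_mem_negativePart {f g : R[T;T⁻¹]} (hf : f ∈ negativePart R)
    (hg : g ∈ negativePart R) : f * g ∈ negativePart R := fun i hi ↦ by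
  rw [← Ideal.mem_bot]
  refine coeff_mul_mem ⊥ fun j k hjk ↦ ?_
  obtain hj | hk : 0 ≤ j ∨ 0 ≤ k := by omega
  · simp [hf j hj]
  · simp [hg k hk]

theorem eq_zero_of_toLaurent_mem_negativePart {p : Polynomial R}
    (hp : Polynomial.toLaurent p ∈ negativePart R) : p = 0 := by
  ext n
  rw [← coeff_toLaurent_natCast, hp n n.cast_nonneg, Polynomial.coeff_zero]

theorem sub_toLaurent_trunc_mem_negativePart (f : R[T;T⁻¹]) :
    f - Polynomial.toLaurent (trunc f) ∈ negativePart R := fun i hi ↦ by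
  lift i to ℕ using hi
  rw [AddMonoidAlgebra.coeff_sub, Finsupp.sub_apply, coeff_toLaurent_natCast]
  exact sub_self _

theorem mem_smul_top_of_coeff_mem {I : Ideal R} {f : R[T;T⁻¹]} (hf : ∀ i, f.coeff i ∈ I) :
    f ∈ I • (⊤ : Submodule R R[T;T⁻¹]) := by
  have : f = ∑ i ∈ f.coeff.support, f.coeff i • T i := by
    ext j
    rw [AddMonoidAlgebra.coeff_sum, Finsupp.finsetSum_apply]
    simp
  rw [this]
  exact sum_mem fun i _ ↦ Submodule.smul_mem_smul (hf i) trivial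

theorem sub_toLaurent_trunc_mem_smul_top {I : Ideal R} {f : R[T;T⁻¹]}
    (hf : f ∈ polynomialMod I) :
    f - Polynomial.toLaurent (trunc f) ∈ I • (⊤ : Submodule R R[T;T⁻¹]) := by
  refine mem_smul_top_of_coeff_mem fun i ↦ ?_
  obtain hi | hi := lt_or_ge i 0
  · rw [AddMonoidAlgebra.coeff_sub, Finsupp.sub_apply, coeff_toLaurent_of_neg _ hi, sub_zero]
    exact hf i hi
  · rw [sub_toLaurent_trunc_mem_negativePart f i hi]
    exact I.zero_mem

end LaurentPolynomial

theorem Submodule.pi_mem_smul_top {R M ι : Type*} [CommRing R] [AddCommGroup M] [Module R M]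
    [Finite ι] {I : Ideal R} {f : ι → M} (hf : ∀ i, f i ∈ I • (⊤ : Submodule R M)) :
    f ∈ I • (⊤ : Submodule R (ι → M)) := by
  classical
  cases nonempty_fintype ι
  rw [← Finset.univ_sum_single f]
  refine sum_mem fun i _ ↦ ?_
  have := Submodule.mem_map_of_mem (f := LinearMap.single R (fun _ : ι ↦ M) i) (hf i)
  rw [Submodule.map_smul''] at this
  exact Submodule.smul_mono le_rfl le_top this

namespace LaurentPolynomial

variable {R : Type*} [CommRing R]

open scoped Matrix in
theorem exists_sub_mulVec_mem_negativePart [IsLocalRing R] {ι κ : Type*} [Fintype ι] [Fintype κ]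
    [DecidableEq κ] (a : Matrix ι κ R[T;T⁻¹]) (b : Matrix κ ι R[T;T⁻¹]) (hba : b * a = 1)
    (ha : ∀ p k, a p k ∈ polynomialMod (IsLocalRing.maximalIdeal R)) (v : κ → R[T;T⁻¹]) :
    ∃ w : ι → Polynomial R, ∀ k, (v - b *ᵥ fun p ↦ Polynomial.toLaurent (w p)) k ∈
      negativePart R := by
  set I := IsLocalRing.maximalIdeal R
  let τ : Polynomial R →ₗ[R] R[T;T⁻¹] := Polynomial.toLaurentAlg.toLinearMap
  let φ : (ι → Polynomial R) →ₗ[R] (κ → R[T;T⁻¹]) :=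
    b.mulVecLin.restrictScalars R ∘ₗ τ.compLeft ι
  have hφ (w) : φ w = b *ᵥ fun p ↦ Polynomial.toLaurent (w p) := rfl
  let N : Submodule R (κ → R[T;T⁻¹]) :=
    LinearMap.range φ ⊔ Submodule.pi Set.univ fun _ ↦ negativePart R
  have hneg {v : κ → R[T;T⁻¹]} (hv : ∀ k, v k ∈ negativePart R) : v ∈ N :=
    Submodule.mem_sup_right fun k _ ↦ hv k
  obtain ⟨D, hD⟩ := exists_toLaurent_eq_T_mul fun x : ι × κ ↦ a x.1 x.2
  choose A hA using hD D le_rfl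
  let W : Submodule R (κ → R[T;T⁻¹]) :=
    LinearMap.range ((τ ∘ₗ (Polynomial.degreeLT R D).subtype).compLeft κ)
  have hWfg : W.FG := by
    have : Module.Finite R (Polynomial.degreeLT R D) :=
      Module.Finite.equiv (Polynomial.degreeLTEquiv R D).symm
    exact Module.Finite.iff_fg.1 (Module.Finite.range _)
  have hsplit {S : Submodule R (κ → R[T;T⁻¹])} (hS : N ≤ S)
      (h : ∀ q : κ → Polynomial R, (fun k ↦ Polynomial.toLaurent (q k)) ∈ S) : ⊤ ≤ S := by
    intro v _
    rw [← sub_add_cancel v fun k ↦ Polynomial.toLaurent (trunc (v k))]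
    exact add_mem (hS (hneg fun k ↦ sub_toLaurent_trunc_mem_negativePart _)) (h _)
  have hNW : ⊤ ≤ N ⊔ W := by
    refine hsplit le_sup_left fun q ↦ ?_
    have : (fun k ↦ Polynomial.toLaurent (q k)) =
        φ (fun p ↦ ∑ k, A (p, k) * (q k /ₘ Polynomial.X ^ D)) +
        fun k ↦ Polynomial.toLaurent (q k %ₘ Polynomial.X ^ D) := by
      have h1 : (fun p ↦ Polynomial.toLaurent (∑ k, A (p, k) * (q k /ₘ Polynomial.X ^ D))) =
          a *ᵥ fun k ↦ T D * Polynomial.toLaurent (q k /ₘ Polynomial.X ^ D) := by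
        ext1 p
        rw [map_sum, Matrix.mulVec, dotProduct]
        refine Finset.sum_congr rfl fun k _ ↦ ?_
        rw [map_mul, hA]
        ring
      rw [hφ, h1, Matrix.mulVec_mulVec, hba, Matrix.one_mulVec]
      ext1 k
      rw [Pi.add_apply, ← Polynomial.toLaurent_X_pow, ← map_mul, ← map_add, add_comm,
        Polynomial.modByMonic_add_div]
    rw [this]
    refine add_mem (Submodule.mem_sup_left (Submodule.mem_sup_left ⟨_, rfl⟩))
      (Submodule.mem_sup_right ⟨fun k ↦ ⟨q k %ₘ Polynomial.X ^ D, ?_⟩, rfl⟩)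
    rw [Polynomial.mem_degreeLT]
    simpa using Polynomial.degree_modByMonic_lt (q k) (Polynomial.monic_X_pow (R := R) D)
  have hNI : ⊤ ≤ N ⊔ I • ⊤ := by
    refine hsplit le_sup_left fun q ↦ ?_
    set f := a *ᵥ fun k ↦ Polynomial.toLaurent (q k)
    have hf (p) : f p ∈ polynomialMod I :=
      sum_mem fun k _ ↦ mul_mem (ha p k) (toLaurent_mem_polynomialMod I _)
    have : (fun k ↦ Polynomial.toLaurent (q k)) = φ (fun p ↦ trunc (f p)) +
        b.mulVecLin.restrictScalars R (f - fun p ↦ Polynomial.toLaurent (trunc (f p))) := by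
      rw [hφ, map_sub]
      simp only [LinearMap.coe_restrictScalars, Matrix.mulVecLin_apply]
      rw [add_sub_cancel, Matrix.mulVec_mulVec, hba, Matrix.one_mulVec]
    rw [this]
    refine add_mem (Submodule.mem_sup_left (Submodule.mem_sup_left ⟨_, rfl⟩))
      (Submodule.mem_sup_right ?_)
    have := Submodule.mem_map_of_mem (f := b.mulVecLin.restrictScalars R)
      (Submodule.pi_mem_smul_top fun p ↦ sub_toLaurent_trunc_mem_smul_top (hf p))
    rw [Submodule.map_smul''] at this
    exact Submodule.smul_mono le_rfl le_top this
  have hW : W ≤ N := by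
    refine Submodule.le_of_le_smul_of_le_jacobson_bot hWfg
      (IsLocalRing.maximalIdeal_le_jacobson _) (le_top.trans (hNI.trans ?_))
    refine sup_le le_sup_left ((Submodule.smul_mono le_rfl hNW).trans ?_)
    rw [Submodule.smul_sup]
    exact sup_le_sup_right Submodule.smul_le_right _
  have hv : v ∈ N := (hNW.trans (sup_le le_rfl hW)) trivial
  obtain ⟨_, ⟨w, rfl⟩, u, hu, rfl⟩ := Submodule.mem_sup.1 hv
  refine ⟨w, fun k ↦ ?_⟩
  rw [← hφ, add_sub_cancel_left]
  exact hu k trivial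

open scoped Matrix in
/-- An idempotent matrix over `R[X]`, with `R` local, whose range becomes free over `R[T;T⁻¹]` has
free range: Horrocks' theorem for the monic polynomial `X`. -/
theorem exists_mul_eq_of_map_toLaurent [IsLocalRing R] {ι : Type*} [Fintype ι] {n : ℕ}
    (E : Matrix ι ι (Polynomial R)) (a : Matrix ι (Fin n) R[T;T⁻¹])
    (b : Matrix (Fin n) ι R[T;T⁻¹]) (hab : a * b = E.map Polynomial.toLaurent)
    (hba : b * a = 1) :
    ∃ (a' : Matrix ι (Fin n) (Polynomial R)) (b' : Matrix (Fin n) ι (Polynomial R)),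
      a' * b' = E ∧ b' * a' = 1 := by
  have hinj {m l : Type _} : Function.Injective
      fun M : Matrix m l (Polynomial R) ↦ M.map Polynomial.toLaurent :=
    Matrix.map_injective Polynomial.toLaurent_injective
  obtain ⟨a, b, hab, hba, ha, hb⟩ : ∃ (a : Matrix ι (Fin n) R[T;T⁻¹])
      (b : Matrix (Fin n) ι R[T;T⁻¹]), a * b = E.map Polynomial.toLaurent ∧ b * a = 1 ∧
      (∀ p k, a p k ∈ polynomialMod (IsLocalRing.maximalIdeal R)) ∧
      ∀ p k, bᵀ p k ∈ polynomialMod (IsLocalRing.maximalIdeal R) := by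
    have hab' (p q) : ∑ i, aᵀ i p * b i q = Polynomial.toLaurent (E p q) := congr_fun₂ hab p q
    obtain ⟨a', b', h1, h2, h3, h4⟩ := exists_dual_families_polynomialMod n aᵀ b
      (fun i j ↦ by rw [← Matrix.one_apply, ← hba]; rfl)
      (fun p q ↦ by
        rw [hab']
        exact toLaurent_mem_polynomialMod _ _)
    refine ⟨Matrix.of fun p i ↦ a' i p, Matrix.of b', ?_, ?_, fun p i ↦ h3 i p,
      fun p i ↦ h4 i p⟩
    · refine Matrix.ext fun p q ↦ ?_
      exact (h2 p q).trans (hab' p q)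
    · refine Matrix.ext fun i j ↦ ?_
      rw [Matrix.one_apply, ← h1]
      rfl
  have hEE : E * E = E := by
    apply hinj
    simp only [Matrix.map_mul, ← hab]
    rw [Matrix.mul_assoc, ← Matrix.mul_assoc b, hba, Matrix.one_mul]
  choose w hw using fun k ↦ exists_sub_mulVec_mem_negativePart a b hba ha (Pi.single k 1)
  choose w' hw' using fun k ↦ exists_sub_mulVec_mem_negativePart bᵀ aᵀ
    (by rw [← Matrix.transpose_mul, hba, Matrix.transpose_one]) hb (Pi.single k 1)
  set h := b * (Matrix.of w)ᵀ.map Polynomial.toLaurent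
  set h' := (Matrix.of w').map Polynomial.toLaurent * a
  have hh (i j) : (1 - h) i j ∈ negativePart R := by
    convert! hw j i using 1
    simp [h, Matrix.mul_apply, Matrix.mulVec, dotProduct, Matrix.one_apply, Pi.single_apply]
  have hh' (i j) : (1 - h') i j ∈ negativePart R := by
    convert! hw' i j using 1
    simp [h', Matrix.mul_apply, Matrix.mulVec, dotProduct, Matrix.one_apply, Pi.single_apply,
      eq_comm, mul_comm]
  set Q := Matrix.of w' * E * (Matrix.of w)ᵀ with hQ
  have hmul : h' * h = Q.map Polynomial.toLaurent := by
    simp only [h, h', hQ, Matrix.map_mul, ← hab, Matrix.mul_assoc]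
  have hw1 : Q = 1 := by
    rw [eq_comm, ← sub_eq_zero]
    refine Matrix.ext fun i j ↦ eq_zero_of_toLaurent_mem_negativePart ?_
    have : Polynomial.toLaurent ((1 - Q) i j) =
        ((1 - h') + (1 - h) - (1 - h') * (1 - h)) i j := by
      rw [show (1 - h') + (1 - h) - (1 - h') * (1 - h) = 1 - h' * h by noncomm_ring, hmul]
      simp [Matrix.one_apply, apply_ite]
    rw [this]
    exact sub_mem (add_mem (hh' i j) (hh i j))
      (sum_mem fun k _ ↦ mul_mem_negativePart (hh' i k) (hh k j))
  have h'h : h' * h = 1 := by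
    rw [hmul, hw1]
    simp
  have hh'1 : h * h' = 1 := mul_eq_one_comm.1 h'h
  refine ⟨E * (Matrix.of w)ᵀ, Matrix.of w' * E, ?_, ?_⟩
  · apply hinj
    simp only [Matrix.map_mul, ← hab]
    calc _ = a * (h * h') * b := by simp only [h, h', Matrix.mul_assoc]
      _ = _ := by rw [hh'1, Matrix.mul_one]
  · rw [Matrix.mul_assoc, ← Matrix.mul_assoc E, hEE, ← Matrix.mul_assoc, ← hQ, hw1]

end LaurentPolynomial

namespace Polynomial

section Patching

variable {B B' : Type*} [CommRing B] [CommRing B'] [Algebra B B'] (S : Submonoid B)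
  [IsLocalization S B']

/-- The endomorphism `X ↦ r X` of `R[X]`. -/
noncomputable def scaleRingHom {R : Type*} [CommRing R] (r : R) : R[X] →+* R[X] :=
  compRingHom (C r * X)

theorem scaleRingHom_C {R : Type*} [CommRing R] (r a : R) : scaleRingHom r (C a) = C a := by
  simp [scaleRingHom]

theorem scaleRingHom_X {R : Type*} [CommRing R] (r : R) : scaleRingHom r X = C r * X := by
  simp [scaleRingHom]

theorem scaleRingHom_comp {R : Type*} [CommRing R] (r s : R) :
    (scaleRingHom r).comp (scaleRingHom s) = scaleRingHom (r * s) := by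
  ext <;> simp [scaleRingHom_C, scaleRingHom_X, mul_assoc, mul_left_comm]

theorem coeff_zero_scaleRingHom {R : Type*} [CommRing R] (r : R) (f : R[X]) :
    (scaleRingHom r f).coeff 0 = f.coeff 0 := by
  simp [scaleRingHom, coeff_zero_eq_eval_zero, eval_comp]

theorem map_scaleRingHom (r : B) (f : B[X]) :
    (scaleRingHom r f).map (algebraMap B B') =
      scaleRingHom (algebraMap B B' r) (f.map (algebraMap B B')) := by
  simp [scaleRingHom, Polynomial.map_comp]

theorem exists_map_eq_scaleRingHom {κ : Type*} [Finite κ] (f : κ → B'[X]) (c : κ → B)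
    (hf : ∀ k, (f k).coeff 0 = algebraMap B B' (c k)) :
    ∃ s ∈ S, ∃ g : κ → B[X], ∀ k, (g k).map (algebraMap B B') =
      scaleRingHom (algebraMap B B' s) (f k) ∧ (g k).coeff 0 = c k := by
  let : Algebra B[X] B'[X] := Polynomial.algebra B B'
  have : IsLocalization (S.map (C : B →+* B[X])) B'[X] := Polynomial.isLocalization _ _
  obtain ⟨⟨_, s, hs, rfl⟩, h⟩ := IsLocalization.exist_integer_multiples_of_finite
    (S.map (C : B →+* B[X])) fun k ↦ (f k).divX
  choose h hh using h
  refine ⟨s, hs, fun k ↦ C (c k) + X * scaleRingHom s (h k), fun k ↦ ⟨?_, by simp⟩⟩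
  replace hh : (h k).map (algebraMap B B') = C (algebraMap B B' s) * (f k).divX := by
    have := hh k
    simpa [Algebra.smul_def, Polynomial.algebraMap_def] using this
  rw [Polynomial.map_add, Polynomial.map_mul, map_scaleRingHom, hh]
  conv_rhs => rw [← X_mul_divX_add (f k)]
  simp only [map_mul, map_add, scaleRingHom_C, scaleRingHom_X, hf, map_X, map_C]
  ring

theorem exists_scaleRingHom_eq_zero {κ : Type*} [Finite κ] (f : κ → B[X])
    (hf : ∀ k, (f k).coeff 0 = 0) (hf' : ∀ k, (f k).map (algebraMap B B') = 0) :
    ∃ s ∈ S, ∀ k, scaleRingHom s (f k) = 0 := by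
  cases nonempty_fintype κ
  let : Algebra B[X] B'[X] := Polynomial.algebra B B'
  have : IsLocalization (S.map (C : B →+* B[X])) B'[X] := Polynomial.isLocalization _ _
  have key : ∀ k, ∃ s ∈ S, C s * (f k).divX = 0 := by
    intro k
    have : algebraMap B[X] B'[X] (f k).divX = 0 := by
      ext n
      simpa [Polynomial.algebraMap_def, coeff_map] using congr(coeff $(hf' k) (n + 1))
    rw [IsLocalization.map_eq_zero_iff (S.map (C : B →+* B[X]))] at this
    obtain ⟨⟨_, s, hs, rfl⟩, h⟩ := this
    exact ⟨s, hs, h⟩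
  choose s hs h using key
  refine ⟨∏ k, s k, prod_mem fun k _ ↦ hs k, fun k ↦ ?_⟩
  have : C (∏ k, s k) * (f k).divX = 0 := by
    obtain ⟨r, hr⟩ := Finset.dvd_prod_of_mem s (Finset.mem_univ k)
    rw [hr, mul_comm (s k), C_mul, mul_assoc, h, mul_zero]
  rw [← X_mul_divX_add (f k), hf, C_0, add_zero, map_mul, scaleRingHom_X]
  have := congr(scaleRingHom (∏ k, s k) $this)
  rw [map_mul, scaleRingHom_C, map_zero] at this
  linear_combination X * this

theorem exists_matrix_mul_eq_map_scaleRingHom {ι : Type*} [Fintype ι] (E : Matrix ι ι B[X])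
    (F : Matrix ι ι B) (hF : F * F = F) (hEF : E.map constantCoeff = F)
    (U V : Matrix ι ι B'[X]) (hU : U.map constantCoeff = F.map (algebraMap B B'))
    (hV : V.map constantCoeff = F.map (algebraMap B B'))
    (hUV : U * V = E.map (mapRingHom (algebraMap B B')))
    (hVU : V * U = (F.map C).map (mapRingHom (algebraMap B B'))) :
    ∃ s ∈ S, ∃ u v : Matrix ι ι B[X], u * v = E.map (scaleRingHom s) ∧ v * u = F.map C := by
  obtain ⟨s, hs, g, hg⟩ := exists_map_eq_scaleRingHom S (B' := B')
    (Sum.elim (fun x : ι × ι ↦ U x.1 x.2) fun x : ι × ι ↦ V x.1 x.2)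
    (Sum.elim (fun x : ι × ι ↦ F x.1 x.2) fun x : ι × ι ↦ F x.1 x.2) (by
      rintro (x | x)
      exacts [congr_fun₂ hU x.1 x.2, congr_fun₂ hV x.1 x.2])
  set σ : B'[X] →+* B'[X] := scaleRingHom (algebraMap B B' s)
  set u : Matrix ι ι B[X] := Matrix.of fun i j ↦ g (.inl (i, j))
  set v : Matrix ι ι B[X] := Matrix.of fun i j ↦ g (.inr (i, j))
  have hu : u.map (mapRingHom (algebraMap B B')) = U.map σ :=
    Matrix.ext fun i j ↦ (hg (.inl (i, j))).1
  have hv : v.map (mapRingHom (algebraMap B B')) = V.map σ :=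
    Matrix.ext fun i j ↦ (hg (.inr (i, j))).1
  have hu0 : u.map constantCoeff = F := Matrix.ext fun i j ↦ (hg (.inl (i, j))).2
  have hv0 : v.map constantCoeff = F := Matrix.ext fun i j ↦ (hg (.inr (i, j))).2
  have key {M N : Matrix ι ι B[X]} (h0 : M.map constantCoeff = N.map constantCoeff)
      (h1 : M.map (mapRingHom (algebraMap B B')) = N.map (mapRingHom (algebraMap B B')))
      (x : ι × ι) :
      ((M - N) x.1 x.2).coeff 0 = 0 ∧ ((M - N) x.1 x.2).map (algebraMap B B') = 0 := by
    constructor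
    · simpa [sub_eq_zero] using congr_fun₂ h0 x.1 x.2
    · simpa [sub_eq_zero] using congr_fun₂ h1 x.1 x.2
  have h1 := key (M := u * v) (N := E.map (scaleRingHom s))
    (by
      rw [Matrix.map_mul, hu0, hv0, hF, ← hEF]
      exact Matrix.ext fun i j ↦ (coeff_zero_scaleRingHom s _).symm)
    (by
      rw [Matrix.map_mul, hu, hv, ← Matrix.map_mul, hUV]
      exact Matrix.ext fun i j ↦ (map_scaleRingHom s _).symm)
  have h2 := key (M := v * u) (N := F.map C)
    (by
      rw [Matrix.map_mul, hu0, hv0, hF]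
      exact Matrix.ext fun i j ↦ by simp)
    (by
      rw [Matrix.map_mul, hu, hv, ← Matrix.map_mul, hVU]
      exact Matrix.ext fun i j ↦ by simp [σ, scaleRingHom_C])
  obtain ⟨r, hr, h⟩ := exists_scaleRingHom_eq_zero S (B' := B')
    (Sum.elim (fun x : ι × ι ↦ (u * v - E.map (scaleRingHom s)) x.1 x.2)
      fun x : ι × ι ↦ (v * u - F.map C) x.1 x.2)
    (by rintro (x | x); exacts [(h1 x).1, (h2 x).1])
    (by rintro (x | x); exacts [(h1 x).2, (h2 x).2])
  refine ⟨r * s, mul_mem hr hs, u.map (scaleRingHom r), v.map (scaleRingHom r), ?_, ?_⟩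
  · rw [← Matrix.map_mul, ← scaleRingHom_comp, ← sub_eq_zero]
    refine Matrix.ext fun i j ↦ ?_
    have := h (.inl (i, j))
    simpa [-Matrix.map_mul] using this
  · rw [← Matrix.map_mul, ← sub_eq_zero]
    refine Matrix.ext fun i j ↦ ?_
    have := h (.inr (i, j))
    simpa [-Matrix.map_mul, scaleRingHom_C] using this

end Patching

section LocalGlobal

/-- The ring homomorphism `R[X] → R[X][Y]` with `X ↦ X + s Y`. -/
noncomputable def shiftRingHom {R : Type*} [CommRing R] (s : R) : R[X] →+* R[X][X] :=
  eval₂RingHom (C.comp C) (C X + C (C s) * X)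

variable {R : Type*} [CommRing R]

@[simp]
theorem shiftRingHom_C (s r : R) : shiftRingHom s (C r) = C (C r) := by simp [shiftRingHom]

@[simp]
theorem shiftRingHom_X (s : R) : shiftRingHom s X = C X + C (C s) * X := by simp [shiftRingHom]

theorem shiftRingHom_zero : shiftRingHom (0 : R) = C := by ext <;> simp

theorem scaleRingHom_comp_shiftRingHom (r s : R) :
    (scaleRingHom (C r)).comp (shiftRingHom s) = shiftRingHom (r * s) := by
  ext <;> simp [scaleRingHom_C, scaleRingHom_X, mul_assoc, mul_left_comm]

theorem constantCoeff_comp_shiftRingHom (s : R) :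
    constantCoeff.comp (shiftRingHom s) = RingHom.id _ := by
  ext <;> simp

theorem mapRingHom_comp_shiftRingHom {R' : Type*} [CommRing R'] (f : R →+* R') :
    (mapRingHom (mapRingHom f)).comp (shiftRingHom 1) = (shiftRingHom 1).comp (mapRingHom f) := by
  ext <;> simp

theorem map_shiftRingHom_map_constantCoeff {k l : Type*} (M : Matrix k l R[X]) (s : R) :
    (M.map (shiftRingHom s)).map constantCoeff = M := by
  rw [Matrix.map_map, ← RingHom.coe_comp, constantCoeff_comp_shiftRingHom]
  simp

theorem map_C_map_constantCoeff {k l : Type*} (M : Matrix k l R) :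
    (M.map C).map constantCoeff = M := by
  ext1
  simp

/-- For an idempotent matrix `E` over `R[X]`, the ideal of those `s : R` for which the ranges of
`E(X + s Y)` and `E(X)` are isomorphic over `R[X, Y]`. -/
def shiftIdeal {ι : Type*} [Fintype ι] (E : Matrix ι ι R[X]) (hE : E * E = E) : Ideal R where
  carrier := {s | ∃ u v : Matrix ι ι R[X][X], u * v = E.map (shiftRingHom s) ∧ v * u = E.map C}
  zero_mem' := ⟨E.map C, E.map C, by rw [← Matrix.map_mul, hE, shiftRingHom_zero], by
    rw [← Matrix.map_mul, hE]⟩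
  smul_mem' r s := by
    rintro ⟨u, v, huv, hvu⟩
    refine ⟨u.map (scaleRingHom (C r)), v.map (scaleRingHom (C r)), ?_, ?_⟩
    · rw [← Matrix.map_mul, huv, Matrix.map_map, ← RingHom.coe_comp,
        scaleRingHom_comp_shiftRingHom, smul_eq_mul]
    · rw [← Matrix.map_mul, hvu, Matrix.map_map]
      exact Matrix.ext fun i j ↦ scaleRingHom_C _ _
  add_mem' {s t} := by
    rintro ⟨u, v, huv, hvu⟩ ⟨u', v', huv', hvu'⟩
    let ρ : R[X][X] →+* R[X][X] := eval₂RingHom (shiftRingHom s) X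
    have h1 : ρ.comp (shiftRingHom t) = shiftRingHom (s + t) := by
      ext <;> simp [ρ, add_mul, add_assoc]
    have h2 : ρ.comp C = shiftRingHom s := by
      ext <;> simp [ρ]
    have huv'ρ := congr(($huv').map ρ)
    have hvu'ρ := congr(($hvu').map ρ)
    rw [Matrix.map_mul, Matrix.map_map, ← RingHom.coe_comp, h1] at huv'ρ
    rw [Matrix.map_mul, Matrix.map_map, ← RingHom.coe_comp, h2, ← huv] at hvu'ρ
    refine ⟨u'.map ρ * u, v * v'.map ρ, ?_, ?_⟩
    · calc _ = u'.map ρ * (u * v) * v'.map ρ := by simp only [Matrix.mul_assoc]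
        _ = (u'.map ρ * v'.map ρ) * (u'.map ρ * v'.map ρ) := by
          rw [← hvu'ρ]; simp only [Matrix.mul_assoc]
        _ = _ := by rw [huv'ρ, ← Matrix.map_mul, hE]
    · calc _ = v * (v'.map ρ * u'.map ρ) * u := by simp only [Matrix.mul_assoc]
        _ = (v * u) * (v * u) := by rw [hvu'ρ]; simp only [Matrix.mul_assoc]
        _ = _ := by rw [hvu, ← Matrix.map_mul, hE]

/-- Quillen patching for idempotent matrices. -/
theorem exists_matrix_mul_eq_map_eval {ι : Type*} [Fintype ι] (E : Matrix ι ι R[X])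
    (hE : E * E = E)
    (h : ∀ (m : Ideal R) [m.IsMaximal], ∃ (n : ℕ)
      (a : Matrix ι (Fin n) (Localization.AtPrime m)[X])
      (b : Matrix (Fin n) ι (Localization.AtPrime m)[X]),
      a * b = E.map (mapRingHom (algebraMap R (Localization.AtPrime m))) ∧ b * a = 1)
    (x y : R) :
    ∃ u v : Matrix ι ι R, u * v = E.map (evalRingHom x) ∧ v * u = E.map (evalRingHom y) := by
  classical
  suffices H : shiftIdeal E hE = ⊤ by
    obtain ⟨u, v, huv, hvu⟩ : x - y ∈ shiftIdeal E hE := H ▸ trivial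
    let ρ : R[X][X] →+* R := (evalRingHom y).comp (evalRingHom 1)
    have h1 : ρ.comp (shiftRingHom (x - y)) = evalRingHom x := by ext <;> simp [ρ]
    have h2 : ρ.comp C = evalRingHom y := by ext <;> simp [ρ]
    refine ⟨u.map ρ, v.map ρ, ?_, ?_⟩
    · rw [← Matrix.map_mul, huv, Matrix.map_map, ← RingHom.coe_comp, h1]
    · rw [← Matrix.map_mul, hvu, Matrix.map_map, ← RingHom.coe_comp, h2]
  by_contra hne
  obtain ⟨m, hm, hle⟩ := Ideal.exists_le_maximal _ hne
  obtain ⟨n, a, b, hab, hba⟩ := h m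
  let L := Localization.AtPrime m
  let : Algebra R[X] L[X] := Polynomial.algebra R L
  have halg : algebraMap R[X] L[X] = mapRingHom (algebraMap R L) := rfl
  have : IsLocalization (m.primeCompl.map (C : R →+* R[X])) L[X] :=
    Polynomial.isLocalization _ _
  have hτ := mapRingHom_comp_shiftRingHom (algebraMap R L)
  obtain ⟨_, ⟨s, hs, rfl⟩, u, v, huv, hvu⟩ := exists_matrix_mul_eq_map_scaleRingHom
    (m.primeCompl.map (C : R →+* R[X])) (B' := L[X]) (E.map (shiftRingHom 1)) E hE
    (map_shiftRingHom_map_constantCoeff _ _)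
    (a.map (shiftRingHom 1) * b.map C) (a.map C * b.map (shiftRingHom 1))
    (by
      rw [Matrix.map_mul, map_shiftRingHom_map_constantCoeff, map_C_map_constantCoeff, hab, halg])
    (by
      rw [Matrix.map_mul, map_shiftRingHom_map_constantCoeff, map_C_map_constantCoeff, hab, halg])
    (by
      rw [halg, Matrix.map_map, ← RingHom.coe_comp, hτ, RingHom.coe_comp, ← Matrix.map_map, ← hab,
        Matrix.map_mul, Matrix.mul_assoc, ← Matrix.mul_assoc (b.map C), ← Matrix.map_mul, hba]
      simp)
    (by
      rw [Matrix.mul_assoc, ← Matrix.mul_assoc (b.map (shiftRingHom 1)), ← Matrix.map_mul, hba]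
      rw [Matrix.map_one _ (map_zero _) (map_one _), Matrix.one_mul, ← Matrix.map_mul, hab, halg]
      exact Matrix.ext fun i j ↦ by simp; rfl)
  refine hs (hle ⟨u, v, ?_, hvu⟩)
  rw [huv, Matrix.map_map, ← RingHom.coe_comp, scaleRingHom_comp_shiftRingHom, mul_one]

end LocalGlobal

end Polynomial

theorem PowerSeries.algebraMap_injective_of_isLocalizationAway_X {R : Type*} [CommRing R]
    (L : Type*) [CommRing L] [Algebra (PowerSeries R) L]
    [IsLocalization.Away (X : PowerSeries R) L] :
    Function.Injective (algebraMap (PowerSeries R) L) :=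
  IsLocalization.injective L (M := Submonoid.powers (X : PowerSeries R))
    (Submonoid.powers_le.2 MvPowerSeries.X_mem_nonzeroDivisors)

namespace Matrix

open Polynomial LaurentPolynomial

variable {R ι : Type*} [CommRing R] {n : ℕ}

/-- If `α * β ≡ X ^ (2 * c) • e` and `β * α ≡ X ^ (2 * c)` modulo `X ^ (4 * c + 2)`, with error
terms `δ` and `γ`, then this idempotent matrix has value `e` at `X = 0`, and its range becomes free
after inverting `X`. -/
noncomputable def gluing (e : Matrix ι ι R) (α : Matrix ι (Fin n) R[X]) (β : Matrix (Fin n) ι R[X])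
    (δ : Matrix ι ι R[X]) (γ : Matrix (Fin n) (Fin n) R[X]) (c : ℕ) :
    Matrix (ι ⊕ Fin n) (ι ⊕ Fin n) R[X] :=
  fromBlocks (e.map Polynomial.C + (X : R[X]) ^ (2 * c + 2) • δ) ((X : R[X]) • α)
    (-((X : R[X]) • (γ * β))) (-((X : R[X]) ^ (2 * c + 2) • γ))

theorem map_gluing {R' : Type*} [CommRing R'] (f : R →+* R') (e : Matrix ι ι R)
    (α : Matrix ι (Fin n) R[X]) (β : Matrix (Fin n) ι R[X])
    (δ : Matrix ι ι R[X]) (γ : Matrix (Fin n) (Fin n) R[X]) (c : ℕ) :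
    (gluing e α β δ γ c).map (mapRingHom f) =
      gluing (e.map f) (α.map (mapRingHom f)) (β.map (mapRingHom f)) (δ.map (mapRingHom f))
        (γ.map (mapRingHom f)) c := by
  rw [gluing, gluing, fromBlocks_map, ← Matrix.map_mul]
  congr 1 <;> ext1 <;> simp [-Matrix.map_mul]

variable [Fintype ι] {e : Matrix ι ι R} {α : Matrix ι (Fin n) R[X]} {β : Matrix (Fin n) ι R[X]}
  {δ : Matrix ι ι R[X]} {γ : Matrix (Fin n) (Fin n) R[X]} {c : ℕ}

theorem exists_mul_eq_gluing_map_toLaurent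
    (hαβ : α * β = (X : R[X]) ^ (2 * c) • e.map Polynomial.C + (X : R[X]) ^ (4 * c + 2) • δ)
    (hβα : β * α = (X : R[X]) ^ (2 * c) • 1 + (X : R[X]) ^ (4 * c + 2) • γ) :
    ∃ (s : Matrix (ι ⊕ Fin n) (Fin n) R[T;T⁻¹]) (p : Matrix (Fin n) (ι ⊕ Fin n) R[T;T⁻¹]),
      s * p = (gluing e α β δ γ c).map toLaurent ∧ p * s = 1 := by
  have h1 : (T (-c) * T (-c) : R[T;T⁻¹]) * toLaurent ((X : R[X]) ^ (2 * c)) = 1 := by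
    rw [map_pow, toLaurent_X, T_pow, ← T_add, ← T_add, ← T_zero]
    congr 1; push_cast; ring
  have h2 : (T (-c) * T (-c) : R[T;T⁻¹]) * toLaurent ((X : R[X]) ^ (4 * c + 2)) =
      toLaurent ((X : R[X]) ^ (2 * c + 2)) := by
    simp only [map_pow, toLaurent_X, T_pow, ← T_add]
    congr 1; push_cast; ring
  have h3 : (T (-c) * T (c + 1) : R[T;T⁻¹]) = toLaurent (X : R[X]) := by
    rw [toLaurent_X, ← T_add]
    congr 1; ring
  have h4 : (T (c + 1) * T (c + 1) : R[T;T⁻¹]) = toLaurent ((X : R[X]) ^ (2 * c + 2)) := by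
    simp only [map_pow, toLaurent_X, T_pow, ← T_add]
    congr 1; push_cast; ring
  refine ⟨fromRows ((T (-c) : R[T;T⁻¹]) • α.map toLaurent)
      (-((T (c + 1) : R[T;T⁻¹]) • γ.map toLaurent)),
    fromCols ((T (-c) : R[T;T⁻¹]) • β.map toLaurent) ((T (c + 1) : R[T;T⁻¹]) • 1), ?_, ?_⟩
  · rw [gluing, fromBlocks_map, fromRows_mul_fromCols]
    simp only [Matrix.smul_mul, Matrix.mul_smul, Matrix.neg_mul, smul_smul, smul_neg,
      Matrix.mul_one, ← Matrix.map_mul, hαβ]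
    congr 1 <;> ext1 i j <;>
      simp only [Matrix.smul_apply, Matrix.neg_apply, Matrix.add_apply, Matrix.map_apply,
        smul_eq_mul, map_add, map_mul, map_neg]
    · linear_combination toLaurent (Polynomial.C (e i j)) * h1 + toLaurent (δ i j) * h2
    · linear_combination toLaurent (α i j) * h3
    · linear_combination -toLaurent ((γ * β) i j) * h3
    · linear_combination -toLaurent (γ i j) * h4
  · rw [fromCols_mul_fromRows]
    simp only [Matrix.smul_mul, Matrix.mul_smul, Matrix.mul_neg, smul_smul, Matrix.one_mul,
      ← Matrix.map_mul, hβα]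
    ext1 i j
    simp only [Matrix.smul_apply, Matrix.neg_apply, Matrix.add_apply, Matrix.map_apply,
      smul_eq_mul, map_add, map_mul]
    have h5 : toLaurent ((1 : Matrix (Fin n) (Fin n) R[X]) i j) =
        (1 : Matrix (Fin n) (Fin n) R[T;T⁻¹]) i j := by
      obtain rfl | hij := eq_or_ne i j
      · simp
      · simp [hij]
    rw [h5]
    linear_combination (1 : Matrix (Fin n) (Fin n) R[T;T⁻¹]) i j * h1 +
      toLaurent (γ i j) * (h2 - h4)

theorem gluing_mul_gluing
    (hαβ : α * β = (X : R[X]) ^ (2 * c) • e.map Polynomial.C + (X : R[X]) ^ (4 * c + 2) • δ)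
    (hβα : β * α = (X : R[X]) ^ (2 * c) • 1 + (X : R[X]) ^ (4 * c + 2) • γ) :
    gluing e α β δ γ c * gluing e α β δ γ c = gluing e α β δ γ c := by
  obtain ⟨s, p, hsp, hps⟩ := exists_mul_eq_gluing_map_toLaurent hαβ hβα
  refine Matrix.map_injective Polynomial.toLaurent_injective ?_
  beta_reduce
  rw [Matrix.map_mul, ← hsp, Matrix.mul_assoc, ← Matrix.mul_assoc p, hps, Matrix.one_mul]

theorem exists_mul_eq_of_polynomial (he : e * e = e)
    (hαβ : α * β = (X : R[X]) ^ (2 * c) • e.map Polynomial.C + (X : R[X]) ^ (4 * c + 2) • δ)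
    (hβα : β * α = (X : R[X]) ^ (2 * c) • 1 + (X : R[X]) ^ (4 * c + 2) • γ) :
    ∃ (x : Matrix ι (Fin n) R) (y : Matrix (Fin n) ι R), x * y = e ∧ y * x = 1 := by
  obtain ⟨u, v, huv, hvu⟩ := exists_matrix_mul_eq_map_eval (gluing e α β δ γ c)
    (gluing_mul_gluing hαβ hβα)
    (fun m _ ↦ by
      set f := algebraMap R (Localization.AtPrime m)
      have h1 := congr(($hαβ).map (mapRingHom f))
      have h2 := congr(($hβα).map (mapRingHom f))
      rw [Matrix.map_mul] at h1 h2
      obtain ⟨s, p, hsp, hps⟩ := exists_mul_eq_gluing_map_toLaurent (e := e.map f)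
        (α := α.map (mapRingHom f)) (β := β.map (mapRingHom f)) (δ := δ.map (mapRingHom f))
        (γ := γ.map (mapRingHom f)) (c := c)
        (h1.trans (Matrix.ext fun i j ↦ by simp))
        (h2.trans (Matrix.ext fun i j ↦ by simp [Matrix.one_apply, apply_ite]))
      rw [map_gluing]
      exact ⟨n, LaurentPolynomial.exists_mul_eq_of_map_toLaurent _ s p hsp hps⟩) 0 1
  have h0 : (gluing e α β δ γ c).map (evalRingHom 0) = fromBlocks e 0 0 0 := by
    rw [gluing, fromBlocks_map]
    congr 1 <;> ext1 <;> simp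
  set s : Matrix (ι ⊕ Fin n) (Fin n) R :=
    fromRows (α.map (evalRingHom 1)) (-γ.map (evalRingHom 1))
  set p : Matrix (Fin n) (ι ⊕ Fin n) R := fromCols (β.map (evalRingHom 1)) 1
  have hαβ' := congr(($hαβ).map (evalRingHom 1))
  have hβα' := congr(($hβα).map (evalRingHom 1))
  rw [Matrix.map_mul] at hαβ' hβα'
  have hps : p * s = 1 := by
    rw [fromCols_mul_fromRows, hβα']
    ext i j
    obtain rfl | hij := eq_or_ne i j <;> simp_all
  have hsp : s * p = (gluing e α β δ γ c).map (evalRingHom 1) := by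
    rw [gluing, fromBlocks_map, fromRows_mul_fromCols, hαβ']
    congr 1
    · ext i j; simp
    · ext i j; simp
    · rw [Matrix.neg_mul, ← Matrix.map_mul]
      ext i j; simp [-Matrix.map_mul]
    · ext i j; simp
  rw [h0] at huv
  rw [← hsp] at hvu
  set F : Matrix (ι ⊕ Fin n) (ι ⊕ Fin n) R := fromBlocks e 0 0 0
  have hF : F * F = F := by simp [F, fromBlocks_multiply, he]
  have hxy : (F * u * s) * (p * v * F) = F := by
    calc _ = F * u * (s * p) * v * F := by simp only [Matrix.mul_assoc]
      _ = F * (u * v) * (u * v) * F := by rw [← hvu]; simp only [Matrix.mul_assoc]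
      _ = F := by simp only [huv, hF]
  have hyx : (p * v * F) * (F * u * s) = 1 := by
    calc _ = p * v * (F * F) * u * s := by simp only [Matrix.mul_assoc]
      _ = p * (v * u) * (v * u) * s := by rw [hF, ← huv]; simp only [Matrix.mul_assoc]
      _ = (p * s) * (p * s) * (p * s) := by rw [hvu]; simp only [Matrix.mul_assoc]
      _ = 1 := by simp only [hps, Matrix.mul_one]
  have hx : F * (F * u * s) = F * u * s := by simp only [← Matrix.mul_assoc, hF]
  generalize F * u * s = x at *
  generalize p * v * F = y at *
  rw [← fromRows_toRows x, ← fromCols_toCols y] at hxy hyx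
  rw [← fromRows_toRows x, fromBlocks_mul_fromRows] at hx
  rw [fromRows_mul_fromCols, fromBlocks_inj] at hxy
  rw [fromCols_mul_fromRows] at hyx
  rw [fromRows_ext_iff] at hx
  refine ⟨x.toRows₁, y.toCols₁, hxy.1, ?_⟩
  have hx₂ : x.toRows₂ = 0 := by simpa using hx.2.symm
  simpa [hx₂] using hyx

theorem exists_map_trunc_mul_map_trunc_eq {k l r : Type*} [Fintype l]
    (M : Matrix k l (PowerSeries R)) (N : Matrix l r (PowerSeries R)) (K : Matrix k r R[X]) (d : ℕ)
    (hK : M * N = K.map coeToPowerSeries.ringHom) : ∃ D : Matrix k r R[X],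
      M.map (PowerSeries.trunc d) * N.map (PowerSeries.trunc d) = K + (X : R[X]) ^ d • D := by
  have h1 (f : PowerSeries R) : (PowerSeries.X : PowerSeries R) ^ d ∣ (f.trunc d : R[X]) - f := by
    rw [PowerSeries.X_pow_dvd_iff]
    intro k hk
    simp [PowerSeries.coeff_trunc, hk]
  have h2 (i j) : X ^ d ∣ (M.map (PowerSeries.trunc d) * N.map (PowerSeries.trunc d) - K) i j := by
    suffices (PowerSeries.X : PowerSeries R) ^ d ∣ coeToPowerSeries.ringHom
        ((M.map (PowerSeries.trunc d) * N.map (PowerSeries.trunc d) - K) i j) by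
      rw [PowerSeries.X_pow_dvd_iff] at this
      rw [Polynomial.X_pow_dvd_iff]
      simpa using this
    rw [Matrix.sub_apply, map_sub, ← Matrix.map_apply (M := K)
      (f := coeToPowerSeries.ringHom), ← hK, Matrix.mul_apply,
      Matrix.mul_apply, map_sum, ← Finset.sum_sub_distrib]
    refine Finset.dvd_sum fun x _ ↦ ?_
    rw [map_mul]
    exact dvd_mul_sub_mul (h1 _) (h1 _)
  choose D hD using h2
  refine ⟨Matrix.of D, Matrix.ext fun i j ↦ ?_⟩
  simpa [sub_eq_iff_eq_add, add_comm] using hD i j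

theorem exists_mul_eq_of_powerSeries (he : e * e = e) (c : ℕ)
    (α : Matrix ι (Fin n) (PowerSeries R)) (β : Matrix (Fin n) ι (PowerSeries R))
    (hαβ : α * β = (PowerSeries.X : PowerSeries R) ^ (2 * c) • e.map PowerSeries.C)
    (hβα : β * α = (PowerSeries.X : PowerSeries R) ^ (2 * c) • 1) :
    ∃ (x : Matrix ι (Fin n) R) (y : Matrix (Fin n) ι R), x * y = e ∧ y * x = 1 := by
  have hC : e.map PowerSeries.C = (e.map Polynomial.C).map coeToPowerSeries.ringHom := by
    ext1; simp
  have hX : (PowerSeries.X : PowerSeries R) ^ (2 * c) = coeToPowerSeries.ringHom (X ^ (2 * c)) := by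
    simp
  obtain ⟨δ, hδ⟩ := exists_map_trunc_mul_map_trunc_eq α β
    ((X : R[X]) ^ (2 * c) • e.map Polynomial.C) (4 * c + 2) (by
      rw [hαβ, hC, hX]
      ext1; simp; ring)
  obtain ⟨γ, hγ⟩ := exists_map_trunc_mul_map_trunc_eq β α ((X : R[X]) ^ (2 * c) • 1) (4 * c + 2) (by
    rw [hβα, hX]
    ext1 i j
    obtain rfl | hij := eq_or_ne i j
    · simp
    · simp [hij])
  exact exists_mul_eq_of_polynomial he hδ hγ

theorem exists_mul_eq_of_localizationAway {L : Type*} [CommRing L] [Algebra (PowerSeries R) L]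
    [Algebra R L] [IsScalarTower R (PowerSeries R) L]
    [IsLocalization.Away (PowerSeries.X : PowerSeries R) L] (he : e * e = e)
    (α : Matrix ι (Fin n) L) (β : Matrix (Fin n) ι L)
    (hαβ : α * β = e.map (algebraMap R _)) (hβα : β * α = 1) :
    ∃ (x : Matrix ι (Fin n) R) (y : Matrix (Fin n) ι R), x * y = e ∧ y * x = 1 := by
  obtain ⟨⟨_, c, rfl⟩, h⟩ := IsLocalization.exist_integer_multiples_of_finite
    (Submonoid.powers (PowerSeries.X : PowerSeries R))
    (Sum.elim (fun x : ι × Fin n ↦ α x.1 x.2) fun x : Fin n × ι ↦ β x.1 x.2)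
  choose f hf using h
  have hinj := PowerSeries.algebraMap_injective_of_isLocalizationAway_X (R := R) L
  set t := algebraMap (PowerSeries R) L PowerSeries.X
  have hα : (Matrix.of fun i j ↦ f (.inl (i, j))).map (algebraMap _ L) = t ^ c • α :=
    Matrix.ext fun i j ↦ by simpa [Algebra.smul_def, t] using hf (.inl (i, j))
  have hβ : (Matrix.of fun i j ↦ f (.inr (i, j))).map (algebraMap _ L) = t ^ c • β :=
    Matrix.ext fun i j ↦ by simpa [Algebra.smul_def, t] using hf (.inr (i, j))
  refine exists_mul_eq_of_powerSeries he c (Matrix.of fun i j ↦ f (.inl (i, j)))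
    (Matrix.of fun i j ↦ f (.inr (i, j))) (Matrix.map_injective hinj ?_)
    (Matrix.map_injective hinj ?_)
  · beta_reduce
    rw [Matrix.map_mul, hα, hβ, Matrix.smul_mul, Matrix.mul_smul, smul_smul, ← pow_add, ← two_mul,
      hαβ]
    ext i j
    simp [t, IsScalarTower.algebraMap_apply R (PowerSeries R) L]
  · beta_reduce
    rw [Matrix.map_mul, hα, hβ, Matrix.smul_mul, Matrix.mul_smul, smul_smul, ← pow_add, ← two_mul,
      hβα]
    ext i j
    obtain rfl | hij := eq_or_ne i j <;> simp_all [t]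

end Matrix

theorem Module.exists_linearEquiv_of_matrix {R M ι : Type*} [CommRing R] [AddCommGroup M]
    [Module R M] [Fintype ι] [DecidableEq ι] {n : ℕ} (f : (ι → R) →ₗ[R] M) (g : M →ₗ[R] ι → R)
    (hfg : f ∘ₗ g = LinearMap.id) (x : Matrix ι (Fin n) R) (y : Matrix (Fin n) ι R)
    (hxy : x * y = LinearMap.toMatrix' (g ∘ₗ f)) (hyx : y * x = 1) :
    Nonempty (M ≃ₗ[R] Fin n → R) := by
  have hxy' : x.toLin' ∘ₗ y.toLin' = g ∘ₗ f := by
    rw [← Matrix.toLin'_mul, hxy, Matrix.toLin'_toMatrix']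
  have hyx' : y.toLin' ∘ₗ x.toLin' = LinearMap.id := by
    rw [← Matrix.toLin'_mul, hyx, Matrix.toLin'_one]
  refine ⟨.ofLinearMap (y.toLin' ∘ₗ g) (f ∘ₗ x.toLin') ?_ ?_⟩
  · calc _ = y.toLin' ∘ₗ (g ∘ₗ f) ∘ₗ x.toLin' := by simp only [LinearMap.comp_assoc]
      _ = (y.toLin' ∘ₗ x.toLin') ∘ₗ (y.toLin' ∘ₗ x.toLin') := by
        rw [← hxy']; simp only [LinearMap.comp_assoc]
      _ = _ := by rw [hyx', LinearMap.id_comp]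
  · calc _ = f ∘ₗ (x.toLin' ∘ₗ y.toLin') ∘ₗ g := by simp only [LinearMap.comp_assoc]
      _ = (f ∘ₗ g) ∘ₗ (f ∘ₗ g) := by rw [hxy']; simp only [LinearMap.comp_assoc]
      _ = _ := by rw [hfg, LinearMap.id_comp]

/-- A finitely generated projective `A`-module that becomes free over the Laurent series
ring `A((t))` (the localization of `A⟦t⟧` away from `t`, an `A`-algebra via
`A → A⟦t⟧ → A((t))`) is free: no nontrivial `GL_n`-torsor over `A` trivializes over
`A((t))`. -/
theorem free_of_free_base_change_laurentSeries (A : Type*) [CommRing A]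
    (P : Type*) [AddCommGroup P] [Module A P]
    [Module.Finite A P] [Module.Projective A P]
    (h : Module.Free (Localization.Away (PowerSeries.X : PowerSeries A))
      (Localization.Away (PowerSeries.X : PowerSeries A) ⊗[A] P)) :
    Module.Free A P := by
  set L := Localization.Away (PowerSeries.X : PowerSeries A)
  cases subsingleton_or_nontrivial A
  · have := Module.subsingleton A P
    infer_instance
  have := (PowerSeries.algebraMap_injective_of_isLocalizationAway_X (R := A) L).nontrivial
  obtain ⟨m, f, g, -, -, hfg⟩ := Module.Finite.exists_comp_eq_id_of_projective A P
  let b := Module.finBasis L (L ⊗[A] P)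
  let b' := Algebra.TensorProduct.basis L (Pi.basisFun A (Fin m))
  have hfg' : f.baseChange L ∘ₗ g.baseChange L = LinearMap.id := by
    rw [← LinearMap.baseChange_comp, hfg, LinearMap.baseChange_id]
  obtain ⟨x, y, hxy, hyx⟩ := Matrix.exists_mul_eq_of_localizationAway
    (e := LinearMap.toMatrix' (g ∘ₗ f))
    (by
      rw [← LinearMap.toMatrix'_comp, LinearMap.comp_assoc, ← LinearMap.comp_assoc f, hfg,
        LinearMap.id_comp])
    (LinearMap.toMatrix b b' (g.baseChange L)) (LinearMap.toMatrix b' b (f.baseChange L))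
    (by
      rw [← LinearMap.toMatrix_comp, ← LinearMap.baseChange_comp, LinearMap.toMatrix_baseChange]
      rfl)
    (by rw [← LinearMap.toMatrix_comp, hfg', LinearMap.toMatrix_id])
  obtain ⟨e⟩ := Module.exists_linearEquiv_of_matrix f g hfg x y hxy hyx
  exact Module.Free.of_equiv e.symm
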